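/- arXiv:2209.00231 — 2 statements merged into one kernel-verified Lean document; each statement's English description precedes it below -/
import Mathlib

section
/- There is an absolute constant C > 0 such that for all θ₁, θ₂ ∈ {+1,−1} and all nonzero ξ, η ∈ ℝ³, the null-form bound ‖Π_{θ₁}(ξ)·γ⁰·Π_{θ₂}(η)‖ ≤ C·∠(θ₁ξ, θ₂η) holds, where ‖·‖ is the operator norm on 4×4 complex matrices. -/
noncomputable def pauli : Fin 3 → Matrix (Fin 2) (Fin 2) ℂ
  | 0 => !![0, 1; 1, 0]
  | 1 => !![0, -Complex.I; Complex.I, 0]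
  | 2 => !![1, 0; 0, -1]

/-- The gamma matrices `γ⁰ = [[I₂,0],[0,−I₂]]`, `γʲ = [[0,σʲ],[−σʲ,0]]` in `2×2` blocks. -/
noncomputable def gammaM : Fin 4 → Matrix (Fin 4) (Fin 4) ℂ
  | 0 => Matrix.reindex finSumFinEquiv finSumFinEquiv
      (Matrix.fromBlocks (1 : Matrix (Fin 2) (Fin 2) ℂ) 0 0 (-1 : Matrix (Fin 2) (Fin 2) ℂ))
  | 1 => Matrix.reindex finSumFinEquiv finSumFinEquiv
      (Matrix.fromBlocks 0 (pauli 0) (-(pauli 0)) 0)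
  | 2 => Matrix.reindex finSumFinEquiv finSumFinEquiv
      (Matrix.fromBlocks 0 (pauli 1) (-(pauli 1)) 0)
  | 3 => Matrix.reindex finSumFinEquiv finSumFinEquiv
      (Matrix.fromBlocks 0 (pauli 2) (-(pauli 2)) 0)

/-- `A(ξ) = Σ_{j=1}^{3} ξ_j γ⁰γʲ`. -/
noncomputable def diracA (ξ : EuclideanSpace ℝ (Fin 3)) : Matrix (Fin 4) (Fin 4) ℂ :=
  ∑ j : Fin 3, (ξ j : ℂ) • (gammaM 0 * gammaM j.succ)

/-- The (massless) Dirac projection symbol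
`Π_θ(ξ) = (1/2)(I₄ + θ|ξ|⁻¹ Σ_j ξ_j γ⁰γʲ)`. -/
noncomputable def diracProj (θ : ℝ) (ξ : EuclideanSpace ℝ (Fin 3)) :
    Matrix (Fin 4) (Fin 4) ℂ :=
  ((1 : ℂ) / 2) • ((1 : Matrix (Fin 4) (Fin 4) ℂ) + ((θ / ‖ξ‖ : ℝ) : ℂ) • diracA ξ)

/-- The operator norm of a `4×4` complex matrix, acting on `ℂ⁴` with the Euclidean norm. -/
noncomputable def opNorm (A : Matrix (Fin 4) (Fin 4) ℂ) : ℝ :=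
  ‖Matrix.toEuclideanCLM (𝕜 := ℂ) (n := Fin 4) A‖

theorem gammaM_zero_eq :
    gammaM 0 = !![1, 0, 0, 0; 0, 1, 0, 0; 0, 0, -1, 0; 0, 0, 0, -1] := by
  ext i j
  fin_cases i <;> fin_cases j <;>
    simp [gammaM, finSumFinEquiv, Fin.addCases]

theorem gammaM_one_eq :
    gammaM 1 = !![0, 0, 0, 1; 0, 0, 1, 0; 0, -1, 0, 0; -1, 0, 0, 0] := by
  ext i j
  fin_cases i <;> fin_cases j <;> simp [gammaM, pauli, finSumFinEquiv, Fin.addCases]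

theorem gammaM_two_eq :
    gammaM 2 = !![0, 0, 0, -Complex.I; 0, 0, Complex.I, 0;
                  0, Complex.I, 0, 0; -Complex.I, 0, 0, 0] := by
  ext i j
  fin_cases i <;> fin_cases j <;> simp [gammaM, pauli, finSumFinEquiv, Fin.addCases]

theorem gammaM_three_eq :
    gammaM 3 = !![0, 0, 1, 0; 0, 0, 0, -1; -1, 0, 0, 0; 0, 1, 0, 0] := by
  ext i j
  fin_cases i <;> fin_cases j <;> simp [gammaM, pauli, finSumFinEquiv, Fin.addCases]

theorem diracA_eq (ξ : EuclideanSpace ℝ (Fin 3)) :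
    diracA ξ = !![0, 0, (ξ 2 : ℂ), ξ 0 - Complex.I * ξ 1;
                  0, 0, ξ 0 + Complex.I * ξ 1, -ξ 2;
                  (ξ 2 : ℂ), ξ 0 - Complex.I * ξ 1, 0, 0;
                  ξ 0 + Complex.I * ξ 1, -ξ 2, 0, 0] := by
  have hsum : diracA ξ = (ξ 0 : ℂ) • (gammaM 0 * gammaM 1) + (ξ 1 : ℂ) • (gammaM 0 * gammaM 2)
      + (ξ 2 : ℂ) • (gammaM 0 * gammaM 3) := Fin.sum_univ_three _
  rw [hsum, gammaM_zero_eq, gammaM_one_eq, gammaM_two_eq, gammaM_three_eq]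
  ext i j
  fin_cases i <;> fin_cases j <;> simp [mul_comm, sub_eq_add_neg]

theorem diracA_mul_gammaM_zero (ξ : EuclideanSpace ℝ (Fin 3)) :
    diracA ξ * gammaM 0 = -(gammaM 0 * diracA ξ) := by
  rw [diracA_eq, gammaM_zero_eq]
  ext i j
  fin_cases i <;> fin_cases j <;> simp [Matrix.mul_apply, Fin.sum_univ_succ]

theorem diracA_mul_self (ξ : EuclideanSpace ℝ (Fin 3)) :
    diracA ξ * diracA ξ = ((‖ξ‖ ^ 2 : ℝ) : ℂ) • (1 : Matrix (Fin 4) (Fin 4) ℂ) := by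
  rw [diracA_eq, EuclideanSpace.real_norm_sq_eq]
  ext i j
  fin_cases i <;> fin_cases j <;>
    simp [Matrix.mul_apply, Fin.sum_univ_succ] <;> ring_nf <;> simp

theorem diracA_smul (c : ℝ) (ξ : EuclideanSpace ℝ (Fin 3)) :
    diracA (c • ξ) = (c : ℂ) • diracA ξ := by
  simp [diracA, Finset.smul_sum, mul_smul]

theorem diracA_sub (ξ η : EuclideanSpace ℝ (Fin 3)) :
    diracA (ξ - η) = diracA ξ - diracA η := by
  simp [diracA, sub_smul]

theorem diracProj_eq (θ : ℝ) (ξ : EuclideanSpace ℝ (Fin 3)) :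
    diracProj θ ξ = ((1 : ℂ) / 2) • (1 + diracA ((θ / ‖ξ‖) • ξ)) := by
  rw [diracProj, diracA_smul]

/-- On unit vectors the product factors through `diracA (v - u)`. -/
theorem one_add_diracA_mul_gammaM_zero_mul {u : EuclideanSpace ℝ (Fin 3)} (hu : ‖u‖ = 1)
    (v : EuclideanSpace ℝ (Fin 3)) :
    (1 + diracA u) * gammaM 0 * (1 + diracA v)
      = gammaM 0 * (1 - diracA u) * diracA (v - u) := by
  have hsq : diracA u * diracA u = 1 := by simp [diracA_mul_self, hu]
  have hcomm : (1 + diracA u) * gammaM 0 = gammaM 0 * (1 - diracA u) := by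
    rw [add_mul, diracA_mul_gammaM_zero]
    noncomm_ring
  have hzero : (1 - diracA u) * (1 + diracA u) = 0 := by
    have : (1 - diracA u) * (1 + diracA u) = 1 - diracA u * diracA u := by noncomm_ring
    rw [this, hsq, sub_self]
  have hsplit : 1 + diracA v = (1 + diracA u) + diracA (v - u) := by
    rw [diracA_sub]
    abel
  rw [hcomm, hsplit, mul_add, mul_assoc, hzero, mul_zero, zero_add]

theorem opNorm_nonneg (A : Matrix (Fin 4) (Fin 4) ℂ) : 0 ≤ opNorm A := norm_nonneg _

theorem opNorm_mul_le (A B : Matrix (Fin 4) (Fin 4) ℂ) :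
    opNorm (A * B) ≤ opNorm A * opNorm B := by
  simpa only [opNorm, map_mul] using norm_mul_le _ _

theorem opNorm_sub_le (A B : Matrix (Fin 4) (Fin 4) ℂ) :
    opNorm (A - B) ≤ opNorm A + opNorm B := by
  simpa only [opNorm, map_sub] using norm_sub_le _ _

theorem opNorm_smul (c : ℂ) (A : Matrix (Fin 4) (Fin 4) ℂ) :
    opNorm (c • A) = ‖c‖ * opNorm A := by
  simp only [opNorm, map_smul, norm_smul]

theorem exists_opNorm_diracA_le :
    ∃ K : ℝ, 0 ≤ K ∧ ∀ ξ : EuclideanSpace ℝ (Fin 3), opNorm (diracA ξ) ≤ K * ‖ξ‖ := by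
  refine ⟨∑ j : Fin 3, opNorm (gammaM 0 * gammaM j.succ),
    Finset.sum_nonneg fun j _ => opNorm_nonneg _, fun ξ => ?_⟩
  rw [opNorm, diracA, map_sum, Finset.sum_mul]
  refine norm_sum_le_of_le _ fun j _ => ?_
  rw [map_smul, norm_smul, Complex.norm_real, mul_comm]
  exact mul_le_mul_of_nonneg_left (PiLp.norm_apply_le ξ j) (norm_nonneg _)

/-- The chord between two unit vectors is at most the arc. -/
theorem norm_sub_le_angle_of_norm_eq_one {E : Type*} [NormedAddCommGroup E]
    [InnerProductSpace ℝ E] {u v : E} (hu : ‖u‖ = 1) (hv : ‖v‖ = 1) :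
    ‖u - v‖ ≤ InnerProductGeometry.angle u v := by
  refine le_of_sq_le_sq ?_ (InnerProductGeometry.angle_nonneg u v)
  have hcos := Real.one_sub_sq_div_two_le_cos (x := InnerProductGeometry.angle u v)
  have hinner := InnerProductGeometry.cos_angle_mul_norm_mul_norm u v
  rw [hu, hv, mul_one, mul_one] at hinner
  rw [norm_sub_sq_real, hu, hv, ← hinner]
  linarith

theorem norm_div_norm_smul_eq_one {θ : ℝ} (hθ : θ = 1 ∨ θ = -1)
    {E : Type*} [NormedAddCommGroup E] [NormedSpace ℝ E] {ξ : E} (hξ : ξ ≠ 0) :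
    ‖(θ / ‖ξ‖) • ξ‖ = 1 := by
  have hne : ‖ξ‖ ≠ 0 := norm_ne_zero_iff.mpr hξ
  rcases hθ with rfl | rfl <;> simp [norm_smul, hne]

theorem angle_div_norm_smul {E : Type*} [NormedAddCommGroup E] [InnerProductSpace ℝ E]
    (θ₁ θ₂ : ℝ) {ξ η : E} (hξ : ξ ≠ 0) (hη : η ≠ 0) :
    InnerProductGeometry.angle ((θ₁ / ‖ξ‖) • ξ) ((θ₂ / ‖η‖) • η)
      = InnerProductGeometry.angle (θ₁ • ξ) (θ₂ • η) := by
  rw [div_eq_inv_mul, div_eq_inv_mul, mul_smul, mul_smul,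
    InnerProductGeometry.angle_smul_left_of_pos _ _ (inv_pos.mpr (norm_pos_iff.mpr hξ)),
    InnerProductGeometry.angle_smul_right_of_pos _ _ (inv_pos.mpr (norm_pos_iff.mpr hη))]

theorem exists_opNorm_one_add_diracA_mul_le :
    ∃ M : ℝ, 0 ≤ M ∧ ∀ u v : EuclideanSpace ℝ (Fin 3), ‖u‖ = 1 →
      opNorm ((1 + diracA u) * gammaM 0 * (1 + diracA v)) ≤ M * ‖v - u‖ := by
  obtain ⟨K, hK0, hK⟩ := exists_opNorm_diracA_le
  obtain ⟨a, ha⟩ : ∃ a, opNorm (gammaM 0) = a := ⟨_, rfl⟩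
  obtain ⟨b, hb⟩ : ∃ b, opNorm 1 = b := ⟨_, rfl⟩
  have ha0 : 0 ≤ a := ha ▸ opNorm_nonneg _
  have hb0 : 0 ≤ b := hb ▸ opNorm_nonneg _
  refine ⟨a * (b + K) * K, by positivity, fun u v hu => ?_⟩
  have hsub : opNorm (1 - diracA u) ≤ b + K := by
    have h := opNorm_sub_le 1 (diracA u)
    have hKu := hK u
    rw [hu, mul_one] at hKu
    linarith
  rw [one_add_diracA_mul_gammaM_zero_mul hu]
  calc opNorm (gammaM 0 * (1 - diracA u) * diracA (v - u))
      ≤ opNorm (gammaM 0 * (1 - diracA u)) * opNorm (diracA (v - u)) := opNorm_mul_le _ _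
    _ ≤ opNorm (gammaM 0) * opNorm (1 - diracA u) * opNorm (diracA (v - u)) :=
      mul_le_mul_of_nonneg_right (opNorm_mul_le _ _) (opNorm_nonneg _)
    _ ≤ a * (b + K) * (K * ‖v - u‖) := by
      rw [ha]
      exact mul_le_mul (mul_le_mul_of_nonneg_left hsub ha0) (hK _) (opNorm_nonneg _)
        (by positivity)
    _ = a * (b + K) * K * ‖v - u‖ := by ring

theorem opNorm_diracProj_mul (θ₁ θ₂ : ℝ) (ξ η : EuclideanSpace ℝ (Fin 3)) :
    opNorm (diracProj θ₁ ξ * gammaM 0 * diracProj θ₂ η)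
      = 1 / 4 * opNorm ((1 + diracA ((θ₁ / ‖ξ‖) • ξ)) * gammaM 0 *
          (1 + diracA ((θ₂ / ‖η‖) • η))) := by
  rw [diracProj_eq, diracProj_eq, smul_mul_assoc, smul_mul_assoc, mul_smul_comm, smul_smul,
    opNorm_smul]
  congr 1
  norm_num

/-- Null-form bound: `‖Π_{θ₁}(ξ) γ⁰ Π_{θ₂}(η)‖ ≤ C ∠(θ₁ξ, θ₂η)`. -/
theorem diracProj_nullform_bound :
    ∃ C : ℝ, 0 < C ∧ ∀ θ₁ θ₂ : ℝ, (θ₁ = 1 ∨ θ₁ = -1) → (θ₂ = 1 ∨ θ₂ = -1) →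
      ∀ ξ η : EuclideanSpace ℝ (Fin 3), ξ ≠ 0 → η ≠ 0 →
        opNorm (diracProj θ₁ ξ * gammaM 0 * diracProj θ₂ η)
          ≤ C * InnerProductGeometry.angle (θ₁ • ξ) (θ₂ • η) := by
  obtain ⟨M, hM0, hM⟩ := exists_opNorm_one_add_diracA_mul_le
  refine ⟨M + 1, by positivity, ?_⟩
  intro θ₁ θ₂ hθ₁ hθ₂ ξ η hξ hη
  rw [opNorm_diracProj_mul, ← angle_div_norm_smul θ₁ θ₂ hξ hη]
  have hu := norm_div_norm_smul_eq_one hθ₁ hξ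
  have hv := norm_div_norm_smul_eq_one hθ₂ hη
  generalize (θ₁ / ‖ξ‖) • ξ = u at hu ⊢
  generalize (θ₂ / ‖η‖) • η = v at hv ⊢
  have hchord := norm_sub_le_angle_of_norm_eq_one hu hv
  rw [norm_sub_rev] at hchord
  have hangle := InnerProductGeometry.angle_nonneg u v
  have hprod := (hM u v hu).trans (mul_le_mul_of_nonneg_left hchord hM0)
  have hnonneg := opNorm_nonneg ((1 + diracA u) * gammaM 0 * (1 + diracA v))
  linarith
end

section
/- Let n ≥ 2, let 2 ≤ q ≤ p < ∞, and let N ≥ 1. There is a constant C = C(n,p,q) > 0 such that for every function f : S^{n−1} → ℂ lying in the linear span of spherical harmonics of degrees ℓ with N ≤ ℓ < 2N, one has the Bernstein-type inequality ‖f‖_{L^p(S^{n−1})} ≤ C·N^{(n−1)(1/q − 1/p)}·‖f‖_{L^q(S^{n−1})}, where the L^r norms are taken with respect to the surface measure on the unit sphere S^{n−1} ⊂ ℝⁿ. -/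
open MeasureTheory

/-- A polynomial with complex coefficients on `ℝⁿ` is harmonic if `ΔP = 0`. -/
def IsHarmonicPoly {n : ℕ} (P : MvPolynomial (Fin n) ℂ) : Prop :=
  ∑ j : Fin n, MvPolynomial.pderiv j (MvPolynomial.pderiv j P) = 0

/-- Evaluation of a complex-coefficient polynomial at a real point. -/
noncomputable def evalPoly {n : ℕ} (P : MvPolynomial (Fin n) ℂ)
    (x : EuclideanSpace ℝ (Fin n)) : ℂ :=
  MvPolynomial.eval (fun j => (x j : ℂ)) P

theorem MvPolynomial.IsHomogeneous.eval_const_mul {σ R : Type*} [CommSemiring R]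
    {P : MvPolynomial σ R} {d : ℕ} (hP : P.IsHomogeneous d) (c : R) (u : σ → R) :
    MvPolynomial.eval (fun j => c * u j) P = c ^ d * MvPolynomial.eval u P := by
  rw [MvPolynomial.eval_eq, MvPolynomial.eval_eq, Finset.mul_sum]
  refine Finset.sum_congr rfl fun m hm => ?_
  have hd : ∑ i ∈ m.support, m i = d := by
    rw [← hP (MvPolynomial.mem_support_iff.mp hm), Finsupp.weight_apply]
    simp [Finsupp.sum]
  simp only [mul_pow, Finset.prod_mul_distrib, Finset.prod_pow_eq_pow_sum, hd]
  ring

theorem MvPolynomial.differentiable_eval {σ : Type*} (P : MvPolynomial σ ℂ) {h : σ → ℂ → ℂ}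
    (hh : ∀ j, Differentiable ℂ (h j)) :
    Differentiable ℂ fun z => MvPolynomial.eval (fun j => h j z) P := by
  simp only [MvPolynomial.eval_eq]
  fun_prop

theorem norm_le_mul_pow_of_inversion {G H : ℂ → ℂ} (hH : Differentiable ℂ H) {D : ℕ}
    (hGH : ∀ z, z ≠ 0 → G z = z ^ D * H z⁻¹) {M : ℝ} (hHM : ∀ z : ℂ, ‖z‖ = 1 → ‖H z‖ ≤ M)
    {z : ℂ} (hz : 1 ≤ ‖z‖) : ‖G z‖ ≤ M * ‖z‖ ^ D := by
  have hz0 : z ≠ 0 := by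
    rintro rfl
    simp at hz
    linarith
  have hle : ‖H z⁻¹‖ ≤ M := by
    refine Complex.norm_le_of_forall_mem_frontier_norm_le (U := Metric.ball 0 1)
      Metric.isBounded_ball hH.diffContOnCl (fun w hw => hHM w ?_) ?_
    · rw [frontier_ball _ one_ne_zero] at hw
      simpa using hw
    · rw [closure_ball _ one_ne_zero]
      simpa using inv_le_one_of_one_le₀ hz
  rw [hGH z hz0, norm_mul, norm_pow, mul_comm]
  gcongr

theorem norm_sub_le_of_inversion {G H : ℂ → ℂ} (hG : Differentiable ℂ G) (hH : Differentiable ℂ H)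
    {N : ℕ} (hN : 1 ≤ N) (hGH : ∀ z, z ≠ 0 → G z = z ^ (4 * N) * H z⁻¹) {M : ℝ}
    (hGM : ∀ z : ℂ, ‖z‖ = 1 → ‖G z‖ ≤ M) (hHM : ∀ z : ℂ, ‖z‖ = 1 → ‖H z‖ ≤ M)
    {z : ℂ} (hz : ‖z - 1‖ < 1 / N) :
    ‖G z - G 1‖ ≤ 2 * Real.exp 4 * M * N * ‖z - 1‖ := by
  have hM : 0 ≤ M := (norm_nonneg _).trans (hGM 1 (by simp))
  have hN0 : (0 : ℝ) < N := by exact_mod_cast hN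
  have bound : ∀ w : ℂ, ‖w - 1‖ < 1 / N → ‖G w‖ ≤ Real.exp 4 * M := by
    intro w hw
    rcases le_total 1 ‖w‖ with h1 | h1
    · have hw' : ‖w‖ ≤ Real.exp (1 / N) := by
        have := norm_le_norm_sub_add w 1
        have := Real.add_one_le_exp (1 / (N : ℝ))
        rw [norm_one] at *
        linarith
      calc ‖G w‖ ≤ M * ‖w‖ ^ (4 * N) := norm_le_mul_pow_of_inversion hH hGH hHM h1
        _ ≤ M * Real.exp (1 / N) ^ (4 * N) := by gcongr
        _ = Real.exp 4 * M := by
          rw [← Real.exp_nat_mul, mul_comm]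
          congr 2
          push_cast
          field_simp
    · have hle : ‖G w‖ ≤ M := by
        refine Complex.norm_le_of_forall_mem_frontier_norm_le (U := Metric.ball 0 1)
          Metric.isBounded_ball hG.diffContOnCl (fun w hw => hGM w ?_) ?_
        · rw [frontier_ball _ one_ne_zero] at hw
          simpa using hw
        · rw [closure_ball _ one_ne_zero]
          simpa using h1
      have : 1 ≤ Real.exp 4 := Real.one_le_exp (by norm_num)
      nlinarith
  have h := Complex.dist_le_div_mul_dist_of_mapsTo_ball (f := G) (c := 1) (R₁ := 1 / N)
    (R₂ := 2 * (Real.exp 4 * M)) hG.differentiableOn (z := z) ?_ (by simpa [dist_eq_norm] using hz)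
  · rw [dist_eq_norm, dist_eq_norm] at h
    refine h.trans_eq ?_
    field_simp
  · intro w hw
    rw [mem_ball_iff_norm] at hw
    rw [mem_closedBall_iff_norm]
    have := norm_sub_le (G w) (G 1)
    have := bound w hw
    have := bound 1 (by simpa using hN0)
    linarith

/-- A point of the complexification of the plane spanned by `x` and `y`. -/
noncomputable def complexCombo {n : ℕ} (x y : EuclideanSpace ℝ (Fin n)) (a b : ℂ) : Fin n → ℂ :=
  fun j => a * x j + b * y j

/-- `z ^ m` times the restriction of `∑ i, P i` to the circle through `x` and `y`, where the point
of the circle at angle `t` corresponds to `z = exp (i t)`. -/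
noncomputable def circleLift {n k : ℕ} (m : ℕ) (P : Fin k → MvPolynomial (Fin n) ℂ)
    (deg : Fin k → ℕ) (x y : EuclideanSpace ℝ (Fin n)) (z : ℂ) : ℂ :=
  ∑ i, z ^ (m - deg i) *
    MvPolynomial.eval (complexCombo x y ((z ^ 2 + 1) / 2) ((z ^ 2 - 1) / (2 * Complex.I))) (P i)

section circleLift

variable {n k : ℕ} {m : ℕ} {P : Fin k → MvPolynomial (Fin n) ℂ} {deg : Fin k → ℕ}
  (x y : EuclideanSpace ℝ (Fin n))

theorem differentiable_circleLift : Differentiable ℂ (circleLift m P deg x y) := by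
  unfold circleLift complexCombo
  refine Differentiable.fun_sum fun i _ => (by fun_prop : Differentiable ℂ _).mul
    (MvPolynomial.differentiable_eval _ fun j => by fun_prop)

theorem circleLift_eq (hP : ∀ i, (P i).IsHomogeneous (deg i)) (hdeg : ∀ i, deg i ≤ m) {z : ℂ}
    (hz : z ≠ 0) :
    circleLift m P deg x y z = z ^ m * ∑ i, MvPolynomial.eval
      (complexCombo x y ((z + z⁻¹) / 2) ((z - z⁻¹) / (2 * Complex.I))) (P i) := by
  rw [circleLift, Finset.mul_sum]
  refine Finset.sum_congr rfl fun i _ => ?_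
  have h : complexCombo x y ((z ^ 2 + 1) / 2) ((z ^ 2 - 1) / (2 * Complex.I)) =
      fun j => z * complexCombo x y ((z + z⁻¹) / 2) ((z - z⁻¹) / (2 * Complex.I)) j := by
    funext j
    simp only [complexCombo]
    field_simp
  rw [h, (hP i).eval_const_mul, ← mul_assoc, ← pow_add, Nat.sub_add_cancel (hdeg i)]

theorem circleLift_inversion (hP : ∀ i, (P i).IsHomogeneous (deg i)) (hdeg : ∀ i, deg i ≤ m)
    {z : ℂ} (hz : z ≠ 0) :
    circleLift m P deg x y z = z ^ (2 * m) * circleLift m P deg x (-y) z⁻¹ := by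
  rw [circleLift_eq x y hP hdeg hz, circleLift_eq x (-y) hP hdeg (inv_ne_zero hz), ← mul_assoc,
    two_mul m, pow_add, mul_assoc (z ^ m), ← mul_pow, mul_inv_cancel₀ hz, one_pow, mul_one, inv_inv]
  congr 1
  refine Finset.sum_congr rfl fun i _ => ?_
  congr 2
  funext j
  simp only [complexCombo, PiLp.neg_apply, Complex.ofReal_neg]
  ring

theorem norm_circleLift (hP : ∀ i, (P i).IsHomogeneous (deg i)) (hdeg : ∀ i, deg i ≤ m) {z : ℂ}
    (hz : ‖z‖ = 1) :
    ‖circleLift m P deg x y z‖ = ‖∑ i, evalPoly (P i) (z.re • x + z.im • y)‖ := by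
  have hz0 : z ≠ 0 := by
    rintro rfl
    simp at hz
  rw [circleLift_eq x y hP hdeg hz0, norm_mul, norm_pow, hz, one_pow, one_mul]
  congr 1
  refine Finset.sum_congr rfl fun i _ => ?_
  rw [evalPoly]
  refine congrFun (congrArg _ (congrArg _ ?_)) _
  funext j
  rw [Complex.inv_eq_conj hz]
  have h1 := Complex.re_eq_add_conj z
  have h2 := Complex.im_eq_sub_conj z
  simp [complexCombo, h1, h2]

end circleLift

theorem norm_sum_evalPoly_sub_le {n k N : ℕ} {P : Fin k → MvPolynomial (Fin n) ℂ}
    {deg : Fin k → ℕ} (hN : 1 ≤ N) (hP : ∀ i, (P i).IsHomogeneous (deg i))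
    (hdeg : ∀ i, deg i ≤ 2 * N) {M : ℝ}
    (hM : ∀ x : EuclideanSpace ℝ (Fin n), ‖x‖ = 1 → ‖∑ i, evalPoly (P i) x‖ ≤ M)
    {x w : EuclideanSpace ℝ (Fin n)} (hx : ‖x‖ = 1) (hw : ‖w‖ = 1) (hxw : ‖w - x‖ < 1 / N) :
    ‖∑ i, evalPoly (P i) x‖ - 2 * Real.exp 4 * M * N * ‖w - x‖ ≤ ‖∑ i, evalPoly (P i) w‖ := by
  rcases eq_or_ne w x with rfl | hne
  · simp
  have hN1 : (1 : ℝ) ≤ N := by exact_mod_cast hN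
  set c : ℝ := inner ℝ x w with hc
  have hsq : ‖w - x‖ ^ 2 = 2 - 2 * c := by
    rw [norm_sub_sq_real, hx, hw, real_inner_comm]
    ring
  have hpos : 0 < ‖w - x‖ := norm_pos_iff.mpr (sub_ne_zero.mpr hne)
  have hlt1 : ‖w - x‖ < 1 := hxw.trans_le (by rw [div_le_one (by linarith)]; exact hN1)
  have hc1 : c < 1 := by nlinarith
  have hc0 : 0 < c := by nlinarith
  have hs2 : 0 < 1 - c ^ 2 := by nlinarith
  set s : ℝ := √(1 - c ^ 2) with hs
  have hs0 : 0 < s := Real.sqrt_pos.mpr hs2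
  have hss : s ^ 2 = 1 - c ^ 2 := Real.sq_sqrt hs2.le
  set y : EuclideanSpace ℝ (Fin n) := s⁻¹ • (w - c • x) with hy
  have hwy : w = c • x + s • y := by
    rw [hy, smul_smul, mul_inv_cancel₀ hs0.ne', one_smul]
    abel
  have hxy : inner ℝ x y = 0 := by
    rw [hy, inner_smul_right, inner_sub_right, inner_smul_right, real_inner_self_eq_norm_sq, hx,
      ← hc]
    ring
  have hyn : ‖y‖ = 1 := by
    have h : ‖y‖ ^ 2 = 1 := by
      rw [hy, norm_smul, mul_pow, norm_sub_sq_real, inner_smul_right, norm_smul, mul_pow, hx, hw,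
        real_inner_comm, ← hc, Real.norm_eq_abs, Real.norm_eq_abs, sq_abs, sq_abs, inv_pow, hss]
      field_simp
      ring
    nlinarith [norm_nonneg y]
  have hcirc : ∀ v : EuclideanSpace ℝ (Fin n), ‖v‖ = 1 → inner ℝ x v = 0 → ∀ z : ℂ, ‖z‖ = 1 →
      ‖z.re • x + z.im • v‖ = 1 := by
    intro v hv hxv z hz
    have h : ‖z.re • x + z.im • v‖ ^ 2 = 1 := by
      rw [norm_add_sq_real, norm_smul, norm_smul, inner_smul_left, inner_smul_right, hxv, hx, hv,
        Real.norm_eq_abs, Real.norm_eq_abs, mul_one, mul_one, sq_abs, sq_abs]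
      have := Complex.sq_norm z
      rw [hz, Complex.normSq_apply] at this
      simp
      linarith
    nlinarith [norm_nonneg (z.re • x + z.im • v)]
  have hbound : ∀ v : EuclideanSpace ℝ (Fin n), ‖v‖ = 1 → inner ℝ x v = 0 → ∀ z : ℂ, ‖z‖ = 1 →
      ‖circleLift (2 * N) P deg x v z‖ ≤ M := by
    intro v hv hxv z hz
    rw [norm_circleLift x v hP hdeg hz]
    exact hM _ (hcirc v hv hxv z hz)
  have hzn : ‖(⟨c, s⟩ : ℂ)‖ = 1 := by
    have := Complex.sq_norm ⟨c, s⟩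
    rw [Complex.normSq_mk] at this
    nlinarith [norm_nonneg (⟨c, s⟩ : ℂ)]
  have hz1 : ‖(⟨c, s⟩ : ℂ) - 1‖ = ‖w - x‖ := by
    have := Complex.sq_norm (⟨c, s⟩ - 1)
    rw [Complex.normSq_apply] at this
    simp at this
    rw [← sq_eq_sq₀ (norm_nonneg _) (norm_nonneg _), this, hsq]
    nlinarith
  have key := norm_sub_le_of_inversion
    (differentiable_circleLift (m := 2 * N) (P := P) (deg := deg) x y)
    (differentiable_circleLift (m := 2 * N) (P := P) (deg := deg) x (-y)) hN
    (fun z hz => by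
      rw [circleLift_inversion x y hP hdeg hz]
      congr 2
      ring)
    (hbound y hyn hxy) (hbound (-y) (by rwa [norm_neg]) (by rw [inner_neg_right, hxy, neg_zero]))
    (z := ⟨c, s⟩) (by rwa [hz1])
  have e1 := norm_circleLift x y hP hdeg (norm_one (α := ℂ))
  have e2 := norm_circleLift x y hP hdeg hzn
  simp only [Complex.one_re, Complex.one_im, one_smul, zero_smul, add_zero] at e1
  simp only [← hwy] at e2
  rw [hz1] at key
  rw [← e1, ← e2]
  have := norm_sub_norm_le (circleLift (2 * N) P deg x y 1) (circleLift (2 * N) P deg x y ⟨c, s⟩)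
  rw [norm_sub_rev] at this
  linarith

open scoped Pointwise in
theorem le_toSphere_cap {n : ℕ} (hn : 1 ≤ n) {δ : ℝ} (hδ : 0 < δ) (hδ1 : δ ≤ 1)
    (x : EuclideanSpace ℝ (Fin n)) (hx : ‖x‖ = 1) :
    ENNReal.ofReal (1 / 4 * (δ / (4 * n)) ^ (n - 1)) ≤
      (volume : Measure (EuclideanSpace ℝ (Fin n))).toSphere
        {w | ‖(w : EuclideanSpace ℝ (Fin n)) - x‖ < δ} := by
  have hn0 : (0 : ℝ) < n := by exact_mod_cast hn
  let i₀ : Fin n := ⟨0, hn⟩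
  obtain ⟨b, hb⟩ := Orthonormal.exists_orthonormalBasis_extension_of_card_eq (𝕜 := ℝ)
    (E := EuclideanSpace ℝ (Fin n)) (ι := Fin n) (by simp) (v := fun _ => x) (s := {i₀})
    (by
      refine ⟨fun _ => hx, fun i j hij => absurd (Subsingleton.elim i j) hij⟩)
  have hb0 : b i₀ = x := hb i₀ rfl
  set η : ℝ := δ / (8 * n) with hη
  let box : Fin n → Set ℝ := fun i => if i = i₀ then Set.Ioo (1 / 4) (1 / 2) else Set.Ioo (-η) η
  let S : Set (EuclideanSpace ℝ (Fin n)) :=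
    (fun y => (b.repr y).ofLp) ⁻¹' Set.univ.pi box
  have hmp : MeasurePreserving (fun y : EuclideanSpace ℝ (Fin n) => (b.repr y).ofLp) :=
    (PiLp.volume_preserving_ofLp (Fin n)).comp b.measurePreserving_repr
  have hvol : volume S = ENNReal.ofReal (1 / 4 * (δ / (4 * n)) ^ (n - 1)) := by
    have hbox : MeasurableSet (Set.univ.pi box) := by
      refine MeasurableSet.univ_pi fun i => ?_
      simp only [box]
      split_ifs <;> exact measurableSet_Ioo
    rw [hmp.measure_preimage hbox.nullMeasurableSet, volume_pi_pi,
      ← Finset.mul_prod_erase _ _ (Finset.mem_univ i₀),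
      Finset.prod_congr rfl (g := fun _ => ENNReal.ofReal (δ / (4 * n)))]
    · rw [Finset.prod_const, Finset.card_erase_of_mem (Finset.mem_univ _), Finset.card_univ,
        Fintype.card_fin, ENNReal.ofReal_mul (by norm_num), ENNReal.ofReal_pow (by positivity)]
      simp only [box, if_true, Real.volume_Ioo]
      norm_num
    · intro i hi
      simp only [box, if_neg (Finset.ne_of_mem_erase hi), Real.volume_Ioo]
      congr 1
      rw [hη]
      field_simp
      norm_num
  have hmeas : MeasurableSet {w : Metric.sphere (0 : EuclideanSpace ℝ (Fin n)) 1 |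
      ‖(w : EuclideanSpace ℝ (Fin n)) - x‖ < δ} :=
    (isOpen_lt (by fun_prop) continuous_const).measurableSet
  rw [Measure.toSphere_apply' _ hmeas, ← hvol]
  have hsub : S ⊆ Set.Ioo (0 : ℝ) 1 • (Subtype.val ''
      {w : Metric.sphere (0 : EuclideanSpace ℝ (Fin n)) 1 |
        ‖(w : EuclideanSpace ℝ (Fin n)) - x‖ < δ}) := by
    intro y hy
    have hy' : ∀ i, b.repr y i ∈ box i := fun i => hy i trivial
    set r := b.repr y i₀ with hr
    obtain ⟨hr1, hr2⟩ : r ∈ Set.Ioo (1 / 4 : ℝ) (1 / 2) := by simpa [box] using hy' i₀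
    have hdecomp : y - r • x = ∑ i ∈ Finset.univ.erase i₀, b.repr y i • b i := by
      rw [sub_eq_iff_eq_add, ← hb0, Finset.sum_erase_add _ _ (Finset.mem_univ i₀), b.sum_repr]
    have hη0 : 0 < η := by positivity
    have hyx : ‖y - r • x‖ ≤ δ / 8 := by
      rw [hdecomp]
      calc _ ≤ ∑ i ∈ Finset.univ.erase i₀, η := by
            refine norm_sum_le_of_le _ fun i hi => ?_
            rw [norm_smul, b.norm_eq_one, mul_one, Real.norm_eq_abs, abs_le]
            have := hy' i
            simp only [box, if_neg (Finset.ne_of_mem_erase hi)] at this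
            exact ⟨this.1.le, this.2.le⟩
        _ ≤ ∑ i : Fin n, η := Finset.sum_le_univ_sum_of_nonneg fun _ => hη0.le
        _ = δ / 8 := by
          simp [hη]
          field_simp
    have hrx : ‖r • x‖ = r := by rw [norm_smul, hx, mul_one, Real.norm_of_nonneg (by linarith)]
    have h1 : ‖y‖ ≤ r + ‖y - r • x‖ := by
      have := norm_add_le (y - r • x) (r • x)
      rw [sub_add_cancel, hrx] at this
      linarith
    have h2 : r ≤ ‖y‖ := by
      have := b.norm_eq_one i₀
      have h3 := abs_real_inner_le_norm (b i₀) y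
      rw [← b.repr_apply_apply, this, one_mul] at h3
      exact (le_abs_self _).trans h3
    have hy0 : 0 < ‖y‖ := by linarith
    refine Set.mem_smul.mpr ⟨‖y‖, ⟨hy0, by linarith⟩, ‖y‖⁻¹ • y, ⟨⟨‖y‖⁻¹ • y, ?_⟩, ?_, rfl⟩, ?_⟩
    · simp [norm_smul, hy0.ne']
    · have h4 : ‖y‖⁻¹ • y - x = ‖y‖⁻¹ • (y - ‖y‖ • x) := by
        rw [smul_sub, smul_smul, inv_mul_cancel₀ hy0.ne', one_smul]
      have h5 : ‖y - ‖y‖ • x‖ ≤ δ / 4 := by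
        have h6 : y - ‖y‖ • x = (y - r • x) - (‖y‖ - r) • x := by
          rw [sub_smul]
          abel
        have h7 := norm_sub_le (y - r • x) ((‖y‖ - r) • x)
        rw [norm_smul, hx, mul_one, Real.norm_of_nonneg (by linarith)] at h7
        rw [h6]
        linarith
      simp only [Set.mem_ofPred_eq]
      rw [h4, norm_smul, norm_inv, norm_norm, inv_mul_lt_iff₀ hy0]
      nlinarith
    · rw [smul_smul, mul_inv_cancel₀ hy0.ne', one_smul]
  refine (measure_mono hsub).trans ?_
  refine le_mul_of_one_le_left' ?_
  simpa using hn

theorem le_mul_rpow_mul_of_rpow_le {a b M κ p q : ℝ} (ha : 0 ≤ a) (hb : 0 ≤ b) (hM : 0 ≤ M)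
    (hκ : 0 < κ) (hq : 0 < q) (hqp : q ≤ p) (h1 : (M / 2) ^ q * κ ≤ a ^ q)
    (h2 : b ^ p ≤ M ^ (p - q) * a ^ q) : b ≤ 2 * κ ^ (-(1 / q - 1 / p)) * a := by
  have hp : 0 < p := hq.trans_le hqp
  have hMa : M ≤ 2 * κ ^ (-(1 / q)) * a := by
    have h : ((M / 2) ^ q * κ) ^ (1 / q) ≤ (a ^ q) ^ (1 / q) := by gcongr
    rw [Real.mul_rpow (by positivity) hκ.le, ← Real.rpow_mul (by positivity),
      ← Real.rpow_mul ha, mul_one_div_cancel hq.ne', Real.rpow_one, Real.rpow_one] at h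
    have hk : 0 < κ ^ (1 / q) := by positivity
    rw [Real.rpow_neg hκ.le, mul_right_comm, ← div_eq_mul_inv, le_div_iff₀ hk]
    linarith
  have h3 : b ^ p ≤ (2 * κ ^ (-(1 / q - 1 / p)) * a) ^ p := by
    have hpq : 0 ≤ p - q := sub_nonneg.mpr hqp
    calc b ^ p ≤ (2 * κ ^ (-(1 / q)) * a) ^ (p - q) * a ^ q := by
          refine h2.trans ?_
          gcongr
      _ = 2 ^ (p - q) * κ ^ (-(1 / q) * (p - q)) * (a ^ (p - q) * a ^ q) := by
          rw [Real.mul_rpow (by positivity) ha, Real.mul_rpow (by positivity) (by positivity),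
            ← Real.rpow_mul hκ.le]
          ring
      _ ≤ 2 ^ p * κ ^ (-(1 / q) * (p - q)) * (a ^ (p - q) * a ^ q) := by
          gcongr
          · norm_num
          · linarith
      _ = (2 * κ ^ (-(1 / q - 1 / p)) * a) ^ p := by
          rw [Real.mul_rpow (by positivity) ha, Real.mul_rpow (by positivity) (by positivity),
            ← Real.rpow_mul hκ.le, ← Real.rpow_add_of_nonneg ha hpq hq.le, sub_add_cancel]
          congr 3
          field_simp
  exact (Real.rpow_le_rpow_iff hb (by positivity) hp).mp h3

theorem eLpNorm_rpow_le_of_norm_le {α E : Type*} [MeasurableSpace α] {μ : Measure α}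
    [NormedAddCommGroup E] {f : α → E} {M p q : ℝ} (hM : ∀ x, ‖f x‖ ≤ M) (hq : 0 < q)
    (hqp : q ≤ p) :
    eLpNorm f (ENNReal.ofReal p) μ ^ p ≤
      ENNReal.ofReal M ^ (p - q) * eLpNorm f (ENNReal.ofReal q) μ ^ q := by
  have hp : 0 < p := hq.trans_le hqp
  have key : ∀ r : ℝ, 0 < r → eLpNorm f (ENNReal.ofReal r) μ ^ r = ∫⁻ x, ‖f x‖ₑ ^ r ∂μ := by
    intro r hr
    rw [eLpNorm_eq_lintegral_rpow_enorm_toReal (by simpa using hr) ENNReal.ofReal_ne_top,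
      ENNReal.toReal_ofReal hr.le, ← ENNReal.rpow_mul, one_div_mul_cancel hr.ne', ENNReal.rpow_one]
  have hpq : 0 ≤ p - q := sub_nonneg.mpr hqp
  rw [key p hp, key q hq, ← lintegral_const_mul' _ _ (by
    exact ENNReal.rpow_ne_top_of_nonneg hpq ENNReal.ofReal_ne_top)]
  refine lintegral_mono fun x => ?_
  calc ‖f x‖ₑ ^ p = ‖f x‖ₑ ^ (p - q) * ‖f x‖ₑ ^ q := by
        rw [← ENNReal.rpow_add_of_nonneg _ _ hpq hq.le, sub_add_cancel]
    _ ≤ _ := by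
        gcongr
        rw [← ofReal_norm]
        exact ENNReal.ofReal_le_ofReal (hM x)

theorem continuous_evalPoly {n : ℕ} (P : MvPolynomial (Fin n) ℂ) : Continuous (evalPoly P) := by
  unfold evalPoly
  exact (MvPolynomial.continuous_eval P).comp (by fun_prop)

theorem eLpNorm_le_of_half_le {α E : Type*} [MeasurableSpace α] {μ : Measure α}
    [IsFiniteMeasure μ] [NormedAddCommGroup E] {f : α → E} (hf : AEStronglyMeasurable f μ)
    {M κ p q : ℝ} (hM0 : 0 ≤ M) (hM : ∀ x, ‖f x‖ ≤ M) (hκ : 0 < κ) (hq : 0 < q) (hqp : q ≤ p)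
    (hμ : ENNReal.ofReal κ ≤ μ {x | M / 2 ≤ ‖f x‖}) :
    eLpNorm f (ENNReal.ofReal p) μ ≤
      ENNReal.ofReal (2 * κ ^ (-(1 / q - 1 / p))) * eLpNorm f (ENNReal.ofReal q) μ := by
  have hfin : ∀ r : ENNReal, eLpNorm f r μ ≠ ⊤ := fun r =>
    (MemLp.of_bound hf M (Filter.Eventually.of_forall hM)).eLpNorm_ne_top
  have h1 : ENNReal.ofReal (M / 2) ^ q * ENNReal.ofReal κ ≤
      eLpNorm f (ENNReal.ofReal q) μ ^ q := by
    have h := mul_meas_ge_le_pow_eLpNorm' μ (p := ENNReal.ofReal q) (by simpa using hq)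
      ENNReal.ofReal_ne_top hf (ENNReal.ofReal (M / 2))
    rw [ENNReal.toReal_ofReal hq.le] at h
    refine le_trans ?_ h
    gcongr
    refine hμ.trans (measure_mono fun x hx => ?_)
    simp only [Set.mem_ofPred_eq] at hx ⊢
    rw [← ofReal_norm]
    exact ENNReal.ofReal_le_ofReal hx
  have h2 := eLpNorm_rpow_le_of_norm_le (μ := μ) hM hq hqp
  rw [← ENNReal.ofReal_toReal (hfin (ENNReal.ofReal q))] at h1 h2 ⊢
  rw [← ENNReal.ofReal_toReal (hfin (ENNReal.ofReal p))] at h2 ⊢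
  have hp : 0 < p := hq.trans_le hqp
  rw [ENNReal.ofReal_rpow_of_nonneg (by positivity) hq.le,
    ENNReal.ofReal_rpow_of_nonneg (by positivity) hq.le, ← ENNReal.ofReal_mul (by positivity),
    ENNReal.ofReal_le_ofReal_iff (by positivity)] at h1
  rw [ENNReal.ofReal_rpow_of_nonneg (by positivity) hp.le,
    ENNReal.ofReal_rpow_of_nonneg (by positivity) (sub_nonneg.mpr hqp),
    ENNReal.ofReal_rpow_of_nonneg (by positivity) hq.le, ← ENNReal.ofReal_mul (by positivity),
    ENNReal.ofReal_le_ofReal_iff (by positivity)] at h2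
  rw [← ENNReal.ofReal_mul (by positivity)]
  exact ENNReal.ofReal_le_ofReal (le_mul_rpow_mul_of_rpow_le (by positivity) (by positivity) hM0 hκ
    hq hqp h1 h2)

/-- Bernstein-type inequality on the sphere: for `f` in the span of spherical harmonics of
degrees `ℓ ∈ [N, 2N)`, `‖f‖_{L^p(S^{n−1})} ≤ C N^{(n−1)(1/q−1/p)} ‖f‖_{L^q(S^{n−1})}`. -/
theorem sphere_bernstein (n : ℕ) (hn : 2 ≤ n) (p q : ℝ) (h2q : 2 ≤ q) (hqp : q ≤ p) :
    ∃ C : ℝ, 0 < C ∧ ∀ N : ℕ, 1 ≤ N →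
      ∀ (f : Metric.sphere (0 : EuclideanSpace ℝ (Fin n)) 1 → ℂ)
        (k : ℕ) (P : Fin k → MvPolynomial (Fin n) ℂ) (deg : Fin k → ℕ),
        (∀ i, (P i).IsHomogeneous (deg i) ∧ IsHarmonicPoly (P i) ∧
          N ≤ deg i ∧ deg i < 2 * N) →
        (∀ ω : Metric.sphere (0 : EuclideanSpace ℝ (Fin n)) 1,
          f ω = ∑ i, evalPoly (P i) (ω : EuclideanSpace ℝ (Fin n))) →
        eLpNorm f (ENNReal.ofReal p)
            (volume : Measure (EuclideanSpace ℝ (Fin n))).toSphere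
          ≤ ENNReal.ofReal (C * (N : ℝ) ^ ((n - 1 : ℝ) * (1 / q - 1 / p))) *
            eLpNorm f (ENNReal.ofReal q)
              (volume : Measure (EuclideanSpace ℝ (Fin n))).toSphere := by
  have hq : 0 < q := by linarith
  have hn0 : (0 : ℝ) < n := by exact_mod_cast (by omega : 0 < n)
  set c : ℝ := 1 / 4 * (1 / (16 * Real.exp 4 * n)) ^ (n - 1) with hc
  have hc0 : 0 < c := by positivity
  refine ⟨2 * c ^ (-(1 / q - 1 / p)), by positivity, fun N hN f k P deg hP hf => ?_⟩
  have hN0 : (0 : ℝ) < N := by exact_mod_cast hN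
  have hN1 : (1 : ℝ) ≤ N := by exact_mod_cast hN
  have hfc : Continuous f := by
    rw [funext hf]
    exact continuous_finsetSum _ fun i _ => (continuous_evalPoly _).comp continuous_subtype_val
  have : Nonempty (Metric.sphere (0 : EuclideanSpace ℝ (Fin n)) 1) :=
    ⟨⟨EuclideanSpace.single ⟨0, by omega⟩ 1, by simp⟩⟩
  obtain ⟨ω₀, -, hω₀⟩ := isCompact_univ.exists_isMaxOn Set.univ_nonempty hfc.norm.continuousOn
  have hM : ∀ ω, ‖f ω‖ ≤ ‖f ω₀‖ := fun ω => hω₀ (Set.mem_univ ω)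
  set δ : ℝ := 1 / (4 * Real.exp 4 * N) with hδ
  have hδ0 : 0 < δ := by positivity
  have hδN : δ ≤ 1 / N := by
    have : 1 ≤ Real.exp 4 := Real.one_le_exp (by norm_num)
    rw [hδ]
    gcongr
    nlinarith
  have hnorm : ∀ ω : Metric.sphere (0 : EuclideanSpace ℝ (Fin n)) 1,
      ‖(ω : EuclideanSpace ℝ (Fin n))‖ = 1 := fun ω => by simp
  set κ : ℝ := 1 / 4 * (δ / (4 * n)) ^ (n - 1) with hκ
  have hcap : ENNReal.ofReal κ ≤ (volume : Measure (EuclideanSpace ℝ (Fin n))).toSphere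
      {ω | ‖f ω₀‖ / 2 ≤ ‖f ω‖} := by
    have hδ1 : δ ≤ 1 := hδN.trans (by rwa [div_le_one hN0])
    refine (le_toSphere_cap (by omega) hδ0 hδ1 (ω₀ : EuclideanSpace ℝ (Fin n))
      (hnorm ω₀)).trans (measure_mono fun ω hω => ?_)
    rw [Set.mem_ofPred_eq] at hω
    have h := norm_sum_evalPoly_sub_le hN (fun i => (hP i).1) (fun i => (hP i).2.2.2.le)
      (M := ‖f ω₀‖) (fun x hx => by simpa only [hf] using hM ⟨x, by simpa using hx⟩) (hnorm ω₀)
      (hnorm ω) (hω.trans_le hδN)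
    rw [← hf, ← hf] at h
    have h' : 2 * Real.exp 4 * ‖f ω₀‖ * N * ‖(ω : EuclideanSpace ℝ (Fin n)) - ω₀‖ ≤
        2 * Real.exp 4 * ‖f ω₀‖ * N * δ := by gcongr
    have h'' : 2 * Real.exp 4 * ‖f ω₀‖ * N * δ = ‖f ω₀‖ / 2 := by
      rw [hδ]
      field_simp
      ring
    rw [Set.mem_ofPred_eq]
    linarith
  have hκc : κ = c * (N : ℝ) ^ (-((n : ℝ) - 1)) := by
    have h : δ / (4 * n) = 1 / (16 * Real.exp 4 * n) * (N : ℝ)⁻¹ := by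
      rw [hδ]
      field_simp
      norm_num
    rw [hκ, hc, h, mul_pow, Real.rpow_neg hN0.le, inv_pow, ← Real.rpow_natCast (N : ℝ),
      Nat.cast_sub (by omega), Nat.cast_one, ← mul_assoc]
  have hmain := eLpNorm_le_of_half_le hfc.aestronglyMeasurable (norm_nonneg _) hM
    (by positivity) hq hqp hcap
  rwa [hκc, Real.mul_rpow hc0.le (by positivity), ← Real.rpow_mul hN0.le, neg_mul_neg,
    ← mul_assoc] at hmain
end
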